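/- arXiv:2007.03237 — 2 statements merged into one kernel-verified Lean document; each statement's English description precedes it below -/
import Mathlib

section
/- Let H be a real Hilbert space with inner product a and induced norm ‖·‖_a, let W be a closed subspace of H, let F : H → ℝ be a continuous linear functional, and let s be a symmetric positive semidefinite bilinear form on H. Let u ∈ H satisfy a(u, v) = F(v) for all v ∈ H, and let u_glo ∈ W satisfy a(u_glo, v) = F(v) for all v ∈ W. Assume there exist C ≥ 0 and Λ > 0 such that (i) |F(w)| ≤ C · s(w, w)^{1/2} for all w ∈ H, and (ii) Λ · s(w, w) ≤ a(w, w) for every w ∈ H satisfying a(w, v) = 0 for all v ∈ W. Then ‖u − u_glo‖_a ≤ Λ^{-1/2} · C. -/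
open scoped RealInnerProductSpace

/-- Theorem 4.3 in abstract form: ‖u − u_glo‖_a ≤ Λ^{-1/2} C. -/
theorem global_multiscale_error
    {H : Type*} [NormedAddCommGroup H] [InnerProductSpace ℝ H] [CompleteSpace H]
    (W : Submodule ℝ H) (hW : IsClosed (W : Set H))
    (F : H →L[ℝ] ℝ)
    (s : H →ₗ[ℝ] H →ₗ[ℝ] ℝ) (hs_symm : ∀ u v, s u v = s v u) (hs_pos : ∀ v, 0 ≤ s v v)
    (u : H) (hu : ∀ v : H, ⟪u, v⟫ = F v)
    (uglo : H) (huglo_mem : uglo ∈ W) (huglo : ∀ v ∈ W, ⟪uglo, v⟫ = F v)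
    (C Λ : ℝ) (hC : 0 ≤ C) (hΛ : 0 < Λ)
    (hF : ∀ w : H, |F w| ≤ C * Real.sqrt (s w w))
    (hgap : ∀ w : H, (∀ v ∈ W, ⟪w, v⟫ = 0) → Λ * s w w ≤ ⟪w, w⟫) :
    ‖u - uglo‖ ≤ Real.sqrt Λ⁻¹ * C := by
  have horth : ∀ v ∈ W, ⟪u - uglo, v⟫ = 0 := fun v hv => by
    rw [inner_sub_left, hu, huglo v hv, sub_self]
  have henergy : ‖u - uglo‖ * ‖u - uglo‖ = F (u - uglo) := by
    rw [← real_inner_self_eq_norm_mul_norm, inner_sub_right, horth uglo huglo_mem, sub_zero,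
      real_inner_comm, hu]
  have hsqrt : Real.sqrt (s (u - uglo) (u - uglo)) ≤ Real.sqrt Λ⁻¹ * ‖u - uglo‖ := by
    rw [← Real.sqrt_mul_self (norm_nonneg (u - uglo)), ← Real.sqrt_mul (inv_nonneg.2 hΛ.le)]
    refine Real.sqrt_le_sqrt ?_
    rw [← real_inner_self_eq_norm_mul_norm, le_inv_mul_iff₀ hΛ]
    exact hgap _ horth
  rcases (norm_nonneg (u - uglo)).eq_or_lt with h | h
  · rw [← h]
    positivity
  · refine le_of_mul_le_mul_right ?_ h
    calc ‖u - uglo‖ * ‖u - uglo‖ = F (u - uglo) := henergy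
      _ ≤ C * Real.sqrt (s (u - uglo) (u - uglo)) := (le_abs_self _).trans (hF _)
      _ ≤ C * (Real.sqrt Λ⁻¹ * ‖u - uglo‖) := mul_le_mul_of_nonneg_left hsqrt hC
      _ = Real.sqrt Λ⁻¹ * C * ‖u - uglo‖ := by ring
end

section
/- Let H be a real Hilbert space with inner product a, let s be a symmetric bilinear form on H, and let π : H → H be a linear map with π ∘ π = π whose range is finite-dimensional with basis φ_1, …, φ_m; assume s is positive definite on the range of π. Suppose ψ_1, …, ψ_m ∈ H satisfy, for each j, a(ψ_j, v) + s(π ψ_j, π v) = s(φ_j, π v) for all v ∈ H. Then H decomposes as the a-orthogonal direct sum of V_glo := span{ψ_1, …, ψ_m} and Ṽ := ker π; that is: (i) a(ψ, v) = 0 whenever ψ ∈ V_glo and v ∈ Ṽ; (ii) V_glo ∩ Ṽ = {0}; and (iii) every u ∈ H can be written as u = u_glo + ũ with u_glo ∈ V_glo and ũ ∈ Ṽ. -/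
open scoped RealInnerProductSpace

/-- Orthogonal decomposition V₀^div = V_glo ⊕_a Ṽ asserted in Section 3.2 of the paper. -/
theorem orthogonal_decomposition_Vglo
    {H : Type*} [NormedAddCommGroup H] [InnerProductSpace ℝ H] [CompleteSpace H]
    (s : H →ₗ[ℝ] H →ₗ[ℝ] ℝ) (hs_symm : ∀ u v, s u v = s v u)
    (π : H →ₗ[ℝ] H) (hproj : π ∘ₗ π = π)
    (m : ℕ) (φ : Fin m → H)
    (hindep : LinearIndependent ℝ φ)
    (hspan : Submodule.span ℝ (Set.range φ) = LinearMap.range π)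
    (hs_posdef : ∀ v ∈ LinearMap.range π, v ≠ 0 → 0 < s v v)
    (ψ : Fin m → H)
    (hψ : ∀ j, ∀ v : H, ⟪ψ j, v⟫ + s (π (ψ j)) (π v) = s (φ j) (π v)) :
    (∀ x ∈ Submodule.span ℝ (Set.range ψ), ∀ v ∈ LinearMap.ker π, ⟪x, v⟫ = 0) ∧
    (Submodule.span ℝ (Set.range ψ) ⊓ LinearMap.ker π = ⊥) ∧
    (∀ u : H, ∃ ug ∈ Submodule.span ℝ (Set.range ψ),
      ∃ ut ∈ LinearMap.ker π, u = ug + ut) := by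
  have hππ : ∀ v, π (π v) = π v := fun v => LinearMap.congr_fun hproj v
  have horth : ∀ x ∈ Submodule.span ℝ (Set.range ψ), ∀ v ∈ LinearMap.ker π, ⟪x, v⟫ = 0 := by
    intro x hx v hv
    rw [LinearMap.mem_ker] at hv
    induction hx using Submodule.span_induction with
    | mem x hx =>
      obtain ⟨j, rfl⟩ := hx
      simpa [hv] using hψ j v
    | zero => simp
    | add x y _ _ hx hy => rw [inner_add_left, hx, hy, add_zero]
    | smul c x _ hx => rw [real_inner_smul_left, hx, mul_zero]
  have hzero : ∀ x ∈ Submodule.span ℝ (Set.range ψ), π x = 0 → x = 0 := fun x hx h =>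
    inner_self_eq_zero.mp (horth x hx x (LinearMap.mem_ker.mpr h))
  have hcomb : ∀ (c : Fin m → ℝ) (v : H),
      ⟪∑ j, c j • ψ j, v⟫ + s (π (∑ j, c j • ψ j)) (π v) = s (∑ j, c j • φ j) (π v) := by
    intro c v
    simp only [sum_inner, real_inner_smul_left, map_sum, map_smul, LinearMap.sum_apply,
      LinearMap.smul_apply, smul_eq_mul, ← Finset.sum_add_distrib, ← mul_add, hψ]
  have hli : LinearIndependent ℝ (π ∘ ψ) := by
    rw [Fintype.linearIndependent_iff]
    intro c hc
    refine Fintype.linearIndependent_iff.mp hindep c ?_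
    have hx : ∑ j, c j • ψ j = 0 := by
      refine hzero _ (Submodule.sum_mem _ fun j _ =>
        Submodule.smul_mem _ _ (Submodule.subset_span ⟨j, rfl⟩)) ?_
      simpa using hc
    have hp : ∑ j, c j • φ j ∈ LinearMap.range π := by
      rw [← hspan]
      exact Submodule.sum_mem _ fun j _ =>
        Submodule.smul_mem _ _ (Submodule.subset_span ⟨j, rfl⟩)
    have hpp : π (∑ j, c j • φ j) = ∑ j, c j • φ j := by
      obtain ⟨w, hw⟩ := hp
      rw [← hw, hππ]
    have hs := hcomb c (∑ j, c j • φ j)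
    rw [hx, hpp, inner_zero_left, map_zero, map_zero, LinearMap.zero_apply, add_zero] at hs
    by_contra hne
    exact (hs_posdef _ hp hne).ne hs
  have hmap : (Submodule.span ℝ (Set.range ψ)).map π = LinearMap.range π := by
    rw [Submodule.map_span, ← Set.range_comp]
    have : FiniteDimensional ℝ (LinearMap.range π) := by
      rw [← hspan]
      exact FiniteDimensional.span_of_finite ℝ (Set.finite_range φ)
    refine Submodule.eq_of_le_of_finrank_eq ?_ ?_
    · rw [Submodule.span_le]
      rintro _ ⟨j, rfl⟩
      exact ⟨ψ j, rfl⟩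
    · rw [← hspan, finrank_span_eq_card hli, finrank_span_eq_card hindep]
  refine ⟨horth, ?_, fun u => ?_⟩
  · rw [Submodule.eq_bot_iff]
    rintro x ⟨hx, hker⟩
    exact hzero x hx hker
  · obtain ⟨g, hg, hgu⟩ : π u ∈ (Submodule.span ℝ (Set.range ψ)).map π := hmap ▸ ⟨u, rfl⟩
    exact ⟨g, hg, u - g, by rw [LinearMap.mem_ker, map_sub, hgu, sub_self], by abel⟩
end
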